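/- Let G be a spider with body v, and let I and J be independent sets of G with |I| = |J| such that I ↭ J, no token of I is (G,I)-rigid, and no token of J is (G,J)-rigid. Suppose that max{|I ∩ N(v)|, |J ∩ N(v)|} ≥ 2 and that some leg L of G satisfies |I_L| ≠ |J_L|. Then there exists a TS-sequence between I and J of length M*(G,I,J) + D*(G,I,J), and this is the minimum possible length of a TS-sequence between I and J. -/

import Mathlib

/-!
Common definitions for formalizing "Shortest Reconfiguration Sequence for
Sliding Tokens on Spiders" (Hoang, Khorramian, Uehara).
-/

namespace SlidingTokenPaper

variable {V : Type*} [Fintype V] [DecidableEq V]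

/-- A finite vertex set is independent in `G`. -/
def IsIndep (G : SimpleGraph V) (I : Finset V) : Prop :=
  ∀ x ∈ I, ∀ y ∈ I, ¬ G.Adj x y

/-- One token slide: a token moves from `x` to `y` along an edge `xy`. -/
def Step (G : SimpleGraph V) (A B : Finset V) : Prop :=
  ∃ x y : V, G.Adj x y ∧ A \ B = {x} ∧ B \ A = {y}

/-- `S` is a TS-sequence between the independent sets `I` and `J` of `G`. -/
def IsTSSeq (G : SimpleGraph V) (I J : Finset V) (S : List (Finset V)) : Prop :=
  S ≠ [] ∧ S.head? = some I ∧ S.getLast? = some J ∧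
  (∀ A ∈ S, IsIndep G A ∧ A.card = I.card) ∧ List.Chain' (Step G) S

/-- The length of a TS-sequence: number of token slides. -/
def len (S : List (Finset V)) : ℕ := S.length - 1

/-- `I ↭ J`: there is a TS-sequence between `I` and `J`. -/
def Reconf (G : SimpleGraph V) (I J : Finset V) : Prop :=
  ∃ S, IsTSSeq G I J S

/-- `M*(G,I,J)`: the minimum over all bijections (target assignments)
`f : I → J` of `∑_{w ∈ I} dist_G(w, f(w))`. -/
noncomputable def Mstar (G : SimpleGraph V) (I J : Finset V) : ℕ :=
  sInf { m : ℕ | ∃ e : {x // x ∈ I} ≃ {y // y ∈ J},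
    m = ∑ x : {x // x ∈ I}, G.dist (x : V) ((e x : V)) }

/-- The number of occurrences of the move `x → y` in `S`. -/
def moveCount (S : List (Finset V)) (x y : V) : ℕ :=
  ((S.zip S.tail).filter fun p => p.1 \ p.2 = {x} ∧ p.2 \ p.1 = {y}).length

/-- `D_G(S, e)`: twice the minimum of the numbers of occurrences of the moves
`x → y` and `y → x` in `S`, where `e = xy`. -/
def detours (S : List (Finset V)) : Sym2 V → ℕ :=
  Sym2.lift ⟨fun x y => 2 * min (moveCount S x y) (moveCount S y x),
    fun x y => by dsimp only; rw [min_comm]⟩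

open scoped Classical in
/-- `D_G(S)`: the total number of detours `S` makes, summed over the edges. -/
noncomputable def totalDetours (G : SimpleGraph V) (S : List (Finset V)) : ℕ :=
  ∑ e ∈ Finset.univ.filter (· ∈ G.edgeSet), detours S e

/-- `D*(G,I,J)`: the minimum number of detours of a TS-sequence between `I` and `J`. -/
noncomputable def Dstar (G : SimpleGraph V) (I J : Finset V) : ℕ :=
  sInf { d : ℕ | ∃ S, IsTSSeq G I J S ∧ d = totalDetours G S }

/-- The token on `u ∈ I` is `(G, I)`-rigid: `u` belongs to every independent set
reachable from `I`. -/
def RigidToken (G : SimpleGraph V) (I : Finset V) (u : V) : Prop :=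
  ∀ I', Reconf G I I' → u ∈ I'

/-- `G` is a spider with body `v`: a tree with exactly one vertex of degree ≥ 3. -/
def IsSpider (G : SimpleGraph V) (v : V) : Prop :=
  G.IsTree ∧ 3 ≤ (G.neighborSet v).ncard ∧ ∀ w, 3 ≤ (G.neighborSet w).ncard → w = v

/-- For adjacent `x, y` in a tree `T`, `side T x y` is the vertex set of `T^x_y`,
the component of `T − xy` containing `y` (vertices strictly closer to `y` than to `x`). -/
def side (G : SimpleGraph V) (x y : V) : Set V :=
  {z | G.dist z y < G.dist z x}

/-- `|I ∩ V(L)|` for the leg `L` of the spider with body `v` containing the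
neighbor `w` of `v`. -/
noncomputable def legCard (G : SimpleGraph V) (I : Finset V) (v w : V) : ℕ :=
  ((I : Set V) ∩ side G v w).ncard

/-- `|I ∩ V(L)| − |J ∩ V(L)|` for the leg `L` of the spider indexed by the
neighbor `w` of the body `v`. -/
noncomputable def legDiff (G : SimpleGraph V) (I J : Finset V) (v w : V) : ℤ :=
  (legCard G I v w : ℤ) - (legCard G J v w : ℤ)

/-- The leg indexed by the neighbor `w₁` of `v` may serve as `L_1` in a labeling
of the legs making `|I∩V(L_i)| − |J∩V(L_i)|` nondecreasing, i.e. it minimizes the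
difference. -/
def IsFirstLeg (G : SimpleGraph V) (I J : Finset V) (v w₁ : V) : Prop :=
  G.Adj v w₁ ∧ ∀ w, G.Adj v w → legDiff G I J v w₁ ≤ legDiff G I J v w

/-- `I_L` for the leg `L` indexed by the neighbor `w` of the body `v`, where the
first leg (indexed by `w₁`) additionally receives `I ∩ {v}`. -/
noncomputable def ILeg (G : SimpleGraph V) (I : Finset V) (v w₁ w : V) : Set V :=
  ((I : Set V) ∩ side G v w) ∪ (if w = w₁ then (I : Set V) ∩ {v} else ∅)

/-- `|I_L|` for the leg `L` indexed by the neighbor `w` of the body `v`. -/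
noncomputable def ILegCard (G : SimpleGraph V) (I : Finset V) (v w₁ w : V) : ℕ :=
  (ILeg G I v w₁ w).ncard

/-- `S` makes a detour over the edge `ab`: both moves `a → b` and `b → a` occur in `S`. -/
def MakesDetour (S : List (Finset V)) (a b : V) : Prop :=
  0 < moveCount S a b ∧ 0 < moveCount S b a

section TreeEdges

variable {V : Type*}

/-- In a tree, the neighbor of `y` on the way to `b` is unique. -/
lemma neighbor_toward_unique {G : SimpleGraph V} (hG : G.IsTree) {b y w w' : V}
    (hw : G.Adj w y) (hw' : G.Adj w' y)
    (h : G.dist b w < G.dist b y) (h' : G.dist b w' < G.dist b y) : w = w' := by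
  obtain ⟨p, hp⟩ := hG.connected.exists_walk_length_eq_dist b w
  obtain ⟨q, hq⟩ := hG.connected.exists_walk_length_eq_dist b w'
  have e := hG.dist_eq_dist_add_one_of_adj b hw
  have e' := hG.dist_eq_dist_add_one_of_adj b hw'
  have hpp : (p.concat hw).IsPath :=
    (p.concat hw).isPath_of_length_eq_dist (by rw [SimpleGraph.Walk.length_concat]; omega)
  have hqp : (q.concat hw').IsPath :=
    (q.concat hw').isPath_of_length_eq_dist (by rw [SimpleGraph.Walk.length_concat]; omega)
  have := (hG.existsUnique_path b y).unique hpp hqp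
  simpa using congrArg SimpleGraph.Walk.penultimate this

/-- In a tree, the only edge joining the two sides of the edge `xy` is `xy` itself. -/
lemma eq_of_adj_of_mem_side {G : SimpleGraph V} (hG : G.IsTree) {b b' x y : V}
    (hxy : G.Adj x y) (hb : G.Adj b b')
    (h : G.dist b x < G.dist b y) (h' : G.dist b' y < G.dist b' x) : b = x ∧ b' = y := by
  have hc := hG.connected
  have e1 := hG.dist_eq_dist_add_one_of_adj b hxy
  have e2 := hG.dist_eq_dist_add_one_of_adj b' hxy
  have e3 := hG.dist_eq_dist_add_one_of_adj x hb
  have e4 := hG.dist_eq_dist_add_one_of_adj y hb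
  simp only [G.dist_comm (u := x), G.dist_comm (u := y)] at e3 e4
  by_cases hy : b' = y
  · subst hy
    have : G.dist b b' = 1 := SimpleGraph.dist_eq_one_iff_adj.2 hb
    exact ⟨hc.dist_eq_zero_iff.1 (by omega), rfl⟩
  · exfalso
    obtain ⟨z, hz, hzd⟩ : ∃ z, G.Adj z y ∧ G.dist b' z < G.dist b' y := by
      obtain ⟨p, hp⟩ := hc.exists_walk_length_eq_dist b' y
      have hn : ¬ p.Nil := SimpleGraph.Walk.not_nil_of_ne hy
      refine ⟨p.penultimate, p.adj_penultimate hn, ?_⟩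
      have h1 := SimpleGraph.dist_le p.dropLast
      have h2 := congrArg SimpleGraph.Walk.length
        (SimpleGraph.Walk.concat_dropLast (p := p) (p.adj_penultimate hn))
      rw [SimpleGraph.Walk.length_concat] at h2
      omega
    have hz' : G.dist b z < G.dist b y := by
      have h1 := hG.dist_eq_dist_add_one_of_adj b' hz
      have h2 := hG.dist_eq_dist_add_one_of_adj z hb
      simp only [G.dist_comm (u := z)] at h2
      omega
    have := neighbor_toward_unique hG hxy hz h hz'
    subst this
    omega

/-- If the edge `xy` separates `a` from `b`, every walk from `a` to `b` is at least as long as the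
detour through that edge. -/
lemma dist_add_one_add_dist_le_length {G : SimpleGraph V} (hG : G.IsTree) {x y : V}
    (hxy : G.Adj x y) {a b : V} (p : G.Walk a b)
    (ha : G.dist a x < G.dist a y) (hb : G.dist b y < G.dist b x) :
    G.dist a x + 1 + G.dist y b ≤ p.length := by
  induction p with
  | nil => omega
  | @cons a c b h p ih =>
    rw [SimpleGraph.Walk.length_cons]
    by_cases hc : G.dist c x < G.dist c y
    · have h1 := ih hc hb
      have h2 := hG.dist_eq_dist_add_one_of_adj x h
      simp only [G.dist_comm (u := x)] at h2
      omega
    · have := hG.dist_ne_of_adj c hxy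
      obtain ⟨rfl, rfl⟩ := eq_of_adj_of_mem_side hG hxy h ha (by omega)
      have := SimpleGraph.dist_le p
      simp only [SimpleGraph.dist_self]
      omega

/-- The distance between two vertices separated by the edge `xy`. -/
lemma dist_of_crossing {G : SimpleGraph V} (hG : G.IsTree) {x y : V}
    (hxy : G.Adj x y) {a b : V}
    (ha : G.dist a x < G.dist a y) (hb : G.dist b y < G.dist b x) :
    G.dist a x + 1 + G.dist y b ≤ G.dist a b := by
  obtain ⟨p, hp⟩ := hG.connected.exists_walk_length_eq_dist a b
  exact hp ▸ dist_add_one_add_dist_le_length hG hxy p ha hb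

/-- Indicator that the path from `a` to `b` in a tree traverses the edge `xy` from `x` to `y`. -/
noncomputable def crossing (G : SimpleGraph V) (a b x y : V) : ℕ :=
  if G.dist a x < G.dist a y ∧ G.dist b y < G.dist b x then 1 else 0

/-- The function on unordered pairs adding up the values of `g` on both orientations. -/
def bothWays (g : V → V → ℕ) : Sym2 V → ℕ :=
  Sym2.lift ⟨fun x y => g x y + g y x, fun _ _ => add_comm _ _⟩

/-- Indicator of the ordered pair `(a, b)`. -/
def dartInd [DecidableEq V] (a b x y : V) : ℕ := if x = a ∧ y = b then 1 else 0

lemma sum_bothWays_dartInd [Fintype V] [DecidableEq V] {G : SimpleGraph V}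
    [DecidablePred (· ∈ G.edgeSet)] {a b : V} (h : G.Adj a b) :
    ∑ e ∈ Finset.univ.filter (· ∈ G.edgeSet), bothWays (dartInd a b) e = 1 := by
  have hne := h.ne
  rw [Finset.sum_eq_single s(a, b)]
  · simp [bothWays, dartInd, hne, hne.symm]
  · intro e
    induction e with | _ x y
    intro _ hxy
    simp only [bothWays, dartInd, Sym2.lift_mk]
    grind [Sym2.eq_iff]
  · simp [h]

lemma sum_bothWays_add [Fintype V] {G : SimpleGraph V}
    [DecidablePred (· ∈ G.edgeSet)] {f g h : V → V → ℕ}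
    (H : ∀ x y, G.Adj x y → f x y = g x y + h x y) :
    ∑ e ∈ Finset.univ.filter (· ∈ G.edgeSet), bothWays f e =
      ∑ e ∈ Finset.univ.filter (· ∈ G.edgeSet), bothWays g e +
      ∑ e ∈ Finset.univ.filter (· ∈ G.edgeSet), bothWays h e := by
  rw [← Finset.sum_add_distrib]
  refine Finset.sum_congr rfl fun e => ?_
  induction e with | _ x y
  intro he
  have hxy : G.Adj x y := by simpa using he
  simp only [bothWays, Sym2.lift_mk, H x y hxy, H y x hxy.symm]
  ring

/-- In a tree, the distance from `a` to `b` is the number of edges separating `a` from `b`. -/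
lemma sum_crossing [Fintype V] {G : SimpleGraph V} (hG : G.IsTree)
    [DecidablePred (· ∈ G.edgeSet)] (a b : V) :
    ∑ e ∈ Finset.univ.filter (· ∈ G.edgeSet), bothWays (crossing G a b) e = G.dist a b := by
  classical
  induction hn : G.dist a b generalizing b with
  | zero =>
    obtain rfl := hG.connected.dist_eq_zero_iff.1 hn
    refine Finset.sum_eq_zero fun e _ => ?_
    induction e with | _ x y
    simp only [bothWays, crossing, Sym2.lift_mk]
    grind
  | succ n ih =>
    obtain ⟨p, hp⟩ := hG.connected.exists_walk_length_eq_dist a b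
    have hnil : ¬ p.Nil := fun h => by
      have := SimpleGraph.Walk.length_eq_zero_iff.2 h; omega
    have hadj := p.adj_penultimate hnil
    have hd : G.dist a p.penultimate = n := by
      have h1 := SimpleGraph.dist_le p.dropLast
      have h2 := congrArg SimpleGraph.Walk.length
        (SimpleGraph.Walk.concat_dropLast (p := p) hadj)
      rw [SimpleGraph.Walk.length_concat] at h2
      have h3 := hG.dist_eq_dist_add_one_of_adj a hadj
      omega
    rw [sum_bothWays_add (g := crossing G a p.penultimate) (h := dartInd p.penultimate b),
      ih _ hd, sum_bothWays_dartInd hadj]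
    generalize p.penultimate = c at hadj hd
    intro x y hxy
    have ha := hG.dist_ne_of_adj a hxy
    have hb := hG.dist_ne_of_adj b hxy
    have hc := hG.dist_ne_of_adj c hxy
    unfold crossing dartInd
    by_cases hbc : G.dist b x < G.dist b y ↔ G.dist c x < G.dist c y
    · have : ¬ (x = c ∧ y = b) := by
        rintro ⟨rfl, rfl⟩
        have := SimpleGraph.dist_eq_one_iff_adj.2 hadj
        rw [G.dist_comm (u := y)] at hbc
        simp [this] at hbc
      grind
    · by_cases h1 : G.dist c x < G.dist c y
      · obtain ⟨rfl, rfl⟩ := eq_of_adj_of_mem_side hG hxy hadj h1 (by grind)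
        grind
      · obtain ⟨rfl, rfl⟩ := eq_of_adj_of_mem_side hG hxy hadj.symm (by grind) (by grind)
        grind

/-- Double counting of the tokens on the `y`-side of the edge `xy`. -/
lemma sum_crossing_balance {G : SimpleGraph V} (hG : G.IsTree) {x y : V} (hxy : G.Adj x y)
    {I J : Finset V} (f : {u // u ∈ I} ≃ {u // u ∈ J}) :
    (∑ u : {u // u ∈ I}, crossing G u (f u) x y) +
      ∑ z ∈ I, (if G.dist z y < G.dist z x then 1 else 0) =
      (∑ u : {u // u ∈ I}, crossing G u (f u) y x) +
      ∑ z ∈ J, (if G.dist z y < G.dist z x then 1 else 0) := by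
  rw [← Finset.sum_coe_sort I, ← Finset.sum_coe_sort J,
    ← Equiv.sum_comp f (fun z : {u // u ∈ J} =>
      if G.dist (z : V) y < G.dist (z : V) x then 1 else 0),
    ← Finset.sum_add_distrib, ← Finset.sum_add_distrib]
  refine Finset.sum_congr rfl fun u _ => ?_
  have h1 := hG.dist_ne_of_adj u hxy
  have h2 := hG.dist_ne_of_adj (f u) hxy
  unfold crossing
  grind

/-- A target assignment of minimum cost never uses an edge in both directions. -/
lemma min_sum_crossing_eq_zero {G : SimpleGraph V} (hG : G.IsTree) {x y : V}
    (hxy : G.Adj x y) {I J : Finset V} (f : {u // u ∈ I} ≃ {u // u ∈ J})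
    (hf : ∀ g : {u // u ∈ I} ≃ {u // u ∈ J},
      ∑ u : {u // u ∈ I}, G.dist (u : V) (f u) ≤
        ∑ u : {u // u ∈ I}, G.dist (u : V) (g u)) :
    min (∑ u : {u // u ∈ I}, crossing G u (f u) x y)
      (∑ u : {u // u ∈ I}, crossing G u (f u) y x) = 0 := by
  classical
  by_contra hne
  have h1 : ∑ u : {u // u ∈ I}, crossing G u (f u) x y ≠ 0 := by omega
  have h2 : ∑ u : {u // u ∈ I}, crossing G u (f u) y x ≠ 0 := by omega
  obtain ⟨a, -, ha⟩ := Finset.exists_ne_zero_of_sum_ne_zero h1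
  obtain ⟨b, -, hb⟩ := Finset.exists_ne_zero_of_sum_ne_zero h2
  simp only [crossing, ne_eq, ite_eq_right_iff, one_ne_zero, imp_false, not_not] at ha hb
  have hab : a ≠ b := by rintro rfl; omega
  have key := hf ((Equiv.swap a b).trans f)
  have hlt : ∑ u : {u // u ∈ I}, G.dist (u : V) (((Equiv.swap a b).trans f) u : V) <
      ∑ u : {u // u ∈ I}, G.dist (u : V) (f u) := by
    have split (F : {u // u ∈ I} → ℕ) :
        ∑ u, F u = ∑ u ∈ (Finset.univ.erase a).erase b, F u + F b + F a := by
      rw [Finset.sum_erase_add _ _ (by simp [hab.symm]),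
        Finset.sum_erase_add _ _ (Finset.mem_univ a)]
    rw [split, split fun u => G.dist (u : V) (f u)]
    have hrest : ∑ u ∈ (Finset.univ.erase a).erase b,
        G.dist (u : V) (((Equiv.swap a b).trans f) u : V) =
        ∑ u ∈ (Finset.univ.erase a).erase b, G.dist (u : V) (f u) := by
      refine Finset.sum_congr rfl fun u hu => ?_
      simp only [Finset.mem_erase] at hu
      simp [Equiv.swap_apply_of_ne_of_ne hu.2.1 hu.1]
    rw [hrest]
    simp only [Equiv.trans_apply, Equiv.swap_apply_left, Equiv.swap_apply_right]
    have hd1 := dist_of_crossing hG hxy ha.1 ha.2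
    have hd2 := dist_of_crossing hG hxy.symm hb.1 hb.2
    have t1 := hG.connected.dist_triangle (u := (a : V)) (v := x) (w := (f b : V))
    have t2 := hG.connected.dist_triangle (u := (b : V)) (v := y) (w := (f a : V))
    omega
  omega

end TreeEdges

section TokenMoves

variable {V : Type*} [DecidableEq V]

lemma moveCount_cons_cons [Fintype V] {A B : Finset V} {l : List (Finset V)} {a b : V}
    (hA : A \ B = {a}) (hB : B \ A = {b}) (x y : V) :
    moveCount (A :: B :: l) x y = dartInd a b x y + moveCount (B :: l) x y := by
  unfold moveCount dartInd
  simp only [List.tail_cons, List.zip_cons_cons, List.filter_cons, hA, hB,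
    Finset.singleton_inj, decide_eq_true_eq]
  split_ifs <;> grind

/-- Every token slide is counted on exactly one edge. -/
lemma sum_moveCount [Fintype V] {G : SimpleGraph V} [DecidablePred (· ∈ G.edgeSet)]
    (S : List (Finset V)) (hS : S.IsChain (Step G)) :
    ∑ e ∈ Finset.univ.filter (· ∈ G.edgeSet), bothWays (moveCount S) e = len S := by
  induction S with
  | nil =>
    refine Finset.sum_eq_zero fun e _ => ?_
    induction e with | _ x y
    simp [bothWays, moveCount]
  | cons A S ih =>
    cases S with
    | nil =>
      refine Finset.sum_eq_zero fun e _ => ?_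
      induction e with | _ x y
      simp [bothWays, moveCount]
    | cons B l =>
      rw [List.isChain_cons_cons] at hS
      obtain ⟨⟨a, b, hab, hA, hB⟩, hl⟩ := hS
      rw [sum_bothWays_add fun x y _ => moveCount_cons_cons hA hB x y,
        sum_bothWays_dartInd hab, ih hl]
      simp only [len, List.length_cons]
      omega

/-- The net number of slides over `xy` is the change of the number of tokens on the `y`-side. -/
lemma moveCount_balance [Fintype V] {G : SimpleGraph V} (hG : G.IsTree) {x y : V}
    (hxy : G.Adj x y) (S : List (Finset V)) (hS : S.IsChain (Step G)) {I J : Finset V}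
    (hI : S.head? = some I) (hJ : S.getLast? = some J) :
    moveCount S x y + ∑ z ∈ I, (if G.dist z y < G.dist z x then 1 else 0) =
      moveCount S y x + ∑ z ∈ J, (if G.dist z y < G.dist z x then 1 else 0) := by
  induction S generalizing I with
  | nil => simp at hI
  | cons A S ih =>
    cases S with
    | nil =>
      obtain rfl : A = I := by simpa using hI
      obtain rfl : A = J := by simpa using hJ
      simp [moveCount]
    | cons B l =>
      obtain rfl : A = I := by simpa using hI
      rw [List.isChain_cons_cons] at hS
      obtain ⟨⟨a, b, hab, hA, hB⟩, hl⟩ := hS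
      have key := ih hl rfl (by simpa using hJ)
      rw [moveCount_cons_cons hA hB, moveCount_cons_cons hA hB]
      have sA := Finset.sum_inter_add_sum_sdiff A B
        (fun z => if G.dist z y < G.dist z x then 1 else 0)
      have sB := Finset.sum_inter_add_sum_sdiff B A
        (fun z => if G.dist z y < G.dist z x then 1 else 0)
      rw [hA, Finset.sum_singleton] at sA
      rw [hB, Finset.sum_singleton, Finset.inter_comm] at sB
      have hslide : dartInd a b x y + (if G.dist a y < G.dist a x then 1 else 0) =
          dartInd a b y x + (if G.dist b y < G.dist b x then 1 else 0) := by
        have ha := hG.dist_ne_of_adj a hxy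
        have hb := hG.dist_ne_of_adj b hxy
        have d : G.dist x y = 1 := SimpleGraph.dist_eq_one_iff_adj.2 hxy
        have d' : G.dist y x = 1 := SimpleGraph.dist_eq_one_iff_adj.2 hxy.symm
        have e1 := fun h h' => eq_of_adj_of_mem_side hG hxy hab h h'
        have e2 := fun h h' => eq_of_adj_of_mem_side hG hxy hab.symm h h'
        unfold dartInd
        grind
      omega

end TokenMoves

/-- In a tree, the length of a TS-sequence exceeds `M*` by exactly its total number of detours. -/
lemma len_eq_Mstar_add_totalDetours {V : Type*} [Fintype V] [DecidableEq V] {G : SimpleGraph V}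
    (hG : G.IsTree) {I J : Finset V} (hcard : I.card = J.card) {S : List (Finset V)}
    (hS : IsTSSeq G I J S) : len S = Mstar G I J + totalDetours G S := by
  classical
  obtain ⟨-, hI, hJ, -, hchain⟩ := hS
  have hne : { m : ℕ | ∃ e : {x // x ∈ I} ≃ {y // y ∈ J},
      m = ∑ x : {x // x ∈ I}, G.dist (x : V) ((e x : V)) }.Nonempty :=
    ⟨_, Finset.equivOfCardEq hcard, rfl⟩
  obtain ⟨f, hf⟩ := Nat.sInf_mem hne
  have hmin : ∀ g : {u // u ∈ I} ≃ {u // u ∈ J},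
      ∑ u : {u // u ∈ I}, G.dist (u : V) (f u) ≤
        ∑ u : {u // u ∈ I}, G.dist (u : V) (g u) :=
    fun g => hf ▸ Nat.sInf_le ⟨g, rfl⟩
  rw [Mstar, hf, ← sum_moveCount S hchain, totalDetours]
  simp_rw [← sum_crossing hG]
  rw [Finset.sum_comm, ← Finset.sum_add_distrib]
  refine Finset.sum_congr (by congr) fun e => ?_
  induction e with | _ x y
  intro he
  have hxy : G.Adj x y := by simpa using he
  have h1 := sum_crossing_balance hG hxy f
  have h2 := min_sum_crossing_eq_zero hG hxy f hmin
  have h3 := moveCount_balance hG hxy S hchain hI hJ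
  simp only [bothWays, detours, Sym2.lift_mk, Finset.sum_add_distrib]
  omega

/-- Lemma 7 of the paper. If `max{|I ∩ N(v)|, |J ∩ N(v)|} ≥ 2`
and some leg `L` has `|I_L| ≠ |J_L|`, then there is a TS-sequence between `I`
and `J` of length `M*(G,I,J) + D*(G,I,J)`, and this is the minimum possible
length of a TS-sequence between `I` and `J`. -/
theorem spider_many_tokens_near_body_shortest
    {V : Type*} [Fintype V] [DecidableEq V] (G : SimpleGraph V) (v : V)
    (hG : IsSpider G v) (I J : Finset V)
    (hI : IsIndep G I) (hJ : IsIndep G J) (hcard : I.card = J.card)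
    (hreconf : Reconf G I J)
    (hIrigid : ∀ u ∈ I, ¬ RigidToken G I u)
    (hJrigid : ∀ u ∈ J, ¬ RigidToken G J u)
    (hmax : 2 ≤ max (((I : Set V) ∩ G.neighborSet v).ncard)
      (((J : Set V) ∩ G.neighborSet v).ncard))
    (w₁ : V) (hw₁ : IsFirstLeg G I J v w₁)
    (hleg : ∃ w, G.Adj v w ∧ ILegCard G I v w₁ w ≠ ILegCard G J v w₁ w) :
    (∃ S, IsTSSeq G I J S ∧ len S = Mstar G I J + Dstar G I J) ∧
    (∀ S, IsTSSeq G I J S → Mstar G I J + Dstar G I J ≤ len S) := by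
  have hlen := fun S (hS : IsTSSeq G I J S) => len_eq_Mstar_add_totalDetours hG.1 hcard hS
  obtain ⟨S₀, hS₀⟩ := hreconf
  have hne : { d : ℕ | ∃ S, IsTSSeq G I J S ∧ d = totalDetours G S }.Nonempty :=
    ⟨_, S₀, hS₀, rfl⟩
  refine ⟨?_, fun S hS => ?_⟩
  · obtain ⟨S, hS, hd⟩ := Nat.sInf_mem hne
    exact ⟨S, hS, by rw [hlen S hS, Dstar, hd]⟩
  · rw [hlen S hS]
    have hle : Dstar G I J ≤ totalDetours G S := Nat.sInf_le ⟨S, hS, rfl⟩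
    omega

end SlidingTokenPaper
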